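/- Let c > 0 be a real number with c ≠ 1. Then for every integer k, ∫_{−1/2}^{1/2} e^{−2πi k x}/(1 + c² tan(πx)²) dx = 1/(c+1) if k = 0, and = (c/(c+1)²)·((c−1)/(c+1))^{|k|−1} if k ≠ 0. -/

import Mathlib

lemma aux_int_exp (m : ℤ) :
    ∫ x in (-(1:ℝ)/2)..(1/2), Complex.exp ((2 * Real.pi * Complex.I) * (m : ℂ) * (x : ℂ))
      = if m = 0 then 1 else 0 := by
  split_ifs with h
  · subst h
    simp
    norm_num
  · have hne : (2 * Real.pi * Complex.I) * (m : ℂ) ≠ 0 := by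
      have : (m : ℂ) ≠ 0 := by exact_mod_cast h
      have hp : (Real.pi : ℂ) ≠ 0 := by exact_mod_cast Real.pi_ne_zero
      simp [this, hp]
    rw [integral_exp_mul_complex hne]
    have : Complex.exp ((2 * Real.pi * Complex.I) * (m : ℂ) * ((1/2 : ℝ) : ℂ))
        = Complex.exp ((2 * Real.pi * Complex.I) * (m : ℂ) * ((-(1:ℝ)/2 : ℝ) : ℂ)) := by
      rw [Complex.exp_eq_exp_iff_exists_int]
      refine ⟨m, ?_⟩
      push_cast
      ring
    rw [this]
    simp

/-- The closed form of the integrand. -/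
lemma aux_closed (c : ℝ) (hc : 0 < c) (x : ℝ) (hx : Real.cos (Real.pi * x) ≠ 0)
    (w q : ℂ) (hw : w = Complex.exp ((2 * Real.pi * Complex.I) * (x : ℂ)))
    (hq : q = ((c : ℂ) - 1) / ((c : ℂ) + 1)) (h1 : 1 - q * w ≠ 0) (h2 : 1 - q * w⁻¹ ≠ 0) :
    1 / ((1 : ℂ) + (c : ℂ) ^ 2 * (Real.tan (Real.pi * x) : ℂ) ^ 2) =
      1 / ((c : ℂ) + 1) + ((c : ℂ) / ((c : ℂ) + 1) ^ 2) * (w * (1 - q * w)⁻¹ +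
        w⁻¹ * (1 - q * w⁻¹)⁻¹) := by
  have hc1 : (c : ℂ) + 1 ≠ 0 := by
    have : c + 1 ≠ 0 := by positivity
    exact_mod_cast this
  have hw0 : w ≠ 0 := by rw [hw]; exact Complex.exp_ne_zero _
  have hC : (Real.cos (Real.pi * x) : ℂ) ≠ 0 := by exact_mod_cast hx
  have hD : (Real.cos (Real.pi * x) : ℂ) ^ 2 + (c : ℂ) ^ 2 * (Real.sin (Real.pi * x) : ℂ) ^ 2 ≠ 0 := by
    have : Real.cos (Real.pi * x) ^ 2 + c ^ 2 * Real.sin (Real.pi * x) ^ 2 ≠ 0 := by positivity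
    exact_mod_cast this
  have hL : 1 / ((1 : ℂ) + (c : ℂ) ^ 2 * (Real.tan (Real.pi * x) : ℂ) ^ 2) =
      (Real.cos (Real.pi * x) : ℂ) ^ 2 / ((Real.cos (Real.pi * x) : ℂ) ^ 2 +
        (c : ℂ) ^ 2 * (Real.sin (Real.pi * x) : ℂ) ^ 2) := by
    rw [Real.tan_eq_sin_div_cos]
    push_cast
    push_cast at hC hD
    rw [div_pow, mul_div_assoc', one_add_div (pow_ne_zero 2 hC), one_div_div]
  have hcos : (Real.cos (Real.pi * x) : ℂ) ^ 2 = (w + 2 + w⁻¹) / 4 := by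
    rw [hw, ← Complex.exp_neg]
    push_cast
    rw [Complex.cos_sq, Complex.cos]
    rw [show 2 * ((Real.pi : ℂ) * x) * Complex.I = 2 * Real.pi * Complex.I * x by ring,
      show -(2 * ((Real.pi : ℂ) * x)) * Complex.I = -(2 * Real.pi * Complex.I * x) by ring]
    ring
  have hsin : (Real.sin (Real.pi * x) : ℂ) ^ 2 = (2 - w - w⁻¹) / 4 := by
    have : (Real.sin (Real.pi * x) : ℂ) ^ 2 = 1 - (Real.cos (Real.pi * x) : ℂ) ^ 2 := by
      rw [eq_sub_iff_add_eq]; exact_mod_cast Real.sin_sq_add_cos_sq _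
    rw [this, hcos]; ring
  have hden : (Real.cos (Real.pi * x) : ℂ) ^ 2 + (c : ℂ) ^ 2 * (Real.sin (Real.pi * x) : ℂ) ^ 2
      = (c + 1) ^ 2 / 4 * ((1 - q * w) * (1 - q * w⁻¹)) := by
    rw [hcos, hsin, hq]
    field_simp
    ring
  rw [hL, hden, hcos]
  have e1 : (w + 2 + w⁻¹) / 4 / (((c : ℂ) + 1) ^ 2 / 4 * ((1 - q * w) * (1 - q * w⁻¹)))
     = (w + 2 + w⁻¹) / (((c : ℂ) + 1) ^ 2 * ((1 - q * w) * (1 - q * w⁻¹))) := by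
    field_simp
  rw [e1, div_eq_iff (mul_ne_zero (pow_ne_zero 2 hc1) (mul_ne_zero h1 h2))]
  have e2 : (1 / ((c : ℂ) + 1) + ((c : ℂ) / ((c : ℂ) + 1) ^ 2) * (w * (1 - q * w)⁻¹ +
        w⁻¹ * (1 - q * w⁻¹)⁻¹)) * (((c : ℂ) + 1) ^ 2 * ((1 - q * w) * (1 - q * w⁻¹)))
      = (c + 1) * ((1 - q * w) * (1 - q * w⁻¹)) + c * (w * (1 - q * w⁻¹) + w⁻¹ * (1 - q * w)) := by
    generalize 1 - q * w = A at *
    generalize 1 - q * w⁻¹ = B at *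
    field_simp
  rw [e2, hq]
  field_simp
  ring

/-- Fourier coefficients on the nonnegative side (halved at zero). -/
noncomputable def auxB (c : ℝ) : ℕ → ℂ
  | 0 => 1 / ((c : ℂ) + 1) / 2
  | n + 1 => ((c : ℂ) / ((c : ℂ) + 1) ^ 2) * (((c : ℂ) - 1) / ((c : ℂ) + 1)) ^ n

lemma aux_q_norm (c : ℝ) (hc : 0 < c) : ‖((c : ℂ) - 1) / ((c : ℂ) + 1)‖ < 1 := by
  have : ((c : ℂ) - 1) / ((c : ℂ) + 1) = (((c - 1) / (c + 1) : ℝ) : ℂ) := by push_cast; rfl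
  rw [this, Complex.norm_real, Real.norm_eq_abs, abs_lt]
  constructor
  · rw [lt_div_iff₀ (by positivity)]; linarith
  · rw [div_lt_iff₀ (by positivity)]; linarith

lemma aux_hasSum (c : ℝ) (hc : 0 < c) (x : ℝ) (hx : Real.cos (Real.pi * x) ≠ 0) (w : ℂ)
    (hw : w = Complex.exp ((2 * Real.pi * Complex.I) * (x : ℂ))) :
    HasSum (fun n : ℕ => auxB c n * (w ^ n + w⁻¹ ^ n))
      (1 / ((1 : ℂ) + (c : ℂ) ^ 2 * (Real.tan (Real.pi * x) : ℂ) ^ 2)) := by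
  have hq := aux_q_norm c hc
  set q := ((c : ℂ) - 1) / ((c : ℂ) + 1) with hqd
  have hwn : ‖w‖ = 1 := by
    rw [hw, Complex.norm_exp]; simp
  have n1 : ‖q * w‖ < 1 := by rw [norm_mul, hwn, mul_one]; exact hq
  have n2 : ‖q * w⁻¹‖ < 1 := by rw [norm_mul, norm_inv, hwn, inv_one, mul_one]; exact hq
  have ne (z : ℂ) (hz : ‖z‖ < 1) : 1 - z ≠ 0 := by
    intro h
    rw [sub_eq_zero] at h
    rw [← h] at hz
    simp at hz
  rw [aux_closed c hc x hx w q hw hqd (ne _ n1) (ne _ n2), ← hasSum_nat_add_iff' 1]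
  have s := (((hasSum_geometric_of_norm_lt_one n1).mul_left w).add
    ((hasSum_geometric_of_norm_lt_one n2).mul_left w⁻¹)).mul_left ((c : ℂ) / ((c : ℂ) + 1) ^ 2)
  convert s using 1
  · rfl
  · funext n
    simp only [auxB, ← hqd]
    ring
  · simp [auxB]
    ring

lemma aux_summable (c : ℝ) (hc : 0 < c) : Summable (fun n : ℕ => ‖auxB c n‖ * 2) := by
  apply Summable.mul_right
  rw [← summable_nat_add_iff 1]
  simp only [auxB, norm_mul, norm_pow]
  exact (summable_geometric_of_lt_one (norm_nonneg _) (aux_q_norm c hc)).mul_left _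

lemma aux_cos (x : ℝ) (h : x ∈ Set.uIoc (-(1:ℝ)/2) (1/2)) (h' : x ≠ 1/2) :
    Real.cos (Real.pi * x) ≠ 0 := by
  rw [Set.uIoc_of_le (by norm_num)] at h
  have h2 : x < 1/2 := lt_of_le_of_ne h.2 h'
  have := h.1
  have hp := Real.pi_pos
  apply ne_of_gt
  apply Real.cos_pos_of_mem_Ioo
  constructor <;> nlinarith

lemma aux_term (b : ℂ) (k : ℤ) (n : ℕ) :
    ∫ x in (-(1:ℝ)/2)..(1/2), Complex.exp (-(2 * Real.pi * Complex.I) * (k : ℂ) * (x : ℂ)) *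
      (b * (Complex.exp ((2 * Real.pi * Complex.I) * (x : ℂ)) ^ n +
        (Complex.exp ((2 * Real.pi * Complex.I) * (x : ℂ)))⁻¹ ^ n)) =
    b * ((if (n : ℤ) - k = 0 then 1 else 0) + (if -(n : ℤ) - k = 0 then 1 else 0)) := by
  rw [← aux_int_exp, ← aux_int_exp, ← intervalIntegral.integral_add,
    ← intervalIntegral.integral_const_mul]
  · congr 1
    funext x
    rw [← Complex.exp_neg, ← Complex.exp_nat_mul, ← Complex.exp_nat_mul, mul_left_comm, mul_add,
      ← Complex.exp_add, ← Complex.exp_add]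
    push_cast
    congr 3 <;> ring_nf
  · exact Continuous.intervalIntegrable (by fun_prop) _ _
  · exact Continuous.intervalIntegrable (by fun_prop) _ _

/-- For real `c > 0`, `c ≠ 1`, and every integer `k`,
`∫_{-1/2}^{1/2} e^{-2πi k x}/(1 + c² tan(πx)²) dx = 1/(c+1)` if `k = 0`, and
`= (c/(c+1)²)·((c-1)/(c+1))^{|k|-1}` if `k ≠ 0`. -/
theorem integral_exp_div_one_add_sq_tan_sq
    (c : ℝ) (hc : 0 < c) (hc1 : c ≠ 1) (k : ℤ) :
    ∫ x in (-(1:ℝ)/2)..(1/2),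
        Complex.exp (-(2 * Real.pi * Complex.I) * (k : ℂ) * (x : ℂ)) /
          ((1 : ℂ) + (c : ℂ) ^ 2 * (Real.tan (Real.pi * x) : ℂ) ^ 2) =
      if k = 0 then 1 / ((c : ℂ) + 1)
      else ((c : ℂ) / ((c : ℂ) + 1) ^ 2) *
        (((c : ℂ) - 1) / ((c : ℂ) + 1)) ^ (k.natAbs - 1) := by
  have hne : ∀ᵐ x : ℝ, x ≠ 1/2 := by
    simp [MeasureTheory.ae_iff, MeasureTheory.measure_singleton]
  have H := intervalIntegral.hasSum_integral_of_dominated_convergence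
    (μ := MeasureTheory.volume) (a := -(1:ℝ)/2) (b := 1/2)
    (F := fun (n : ℕ) (x : ℝ) => Complex.exp (-(2 * Real.pi * Complex.I) * (k : ℂ) * (x : ℂ)) *
      (auxB c n * (Complex.exp ((2 * Real.pi * Complex.I) * (x : ℂ)) ^ n +
        (Complex.exp ((2 * Real.pi * Complex.I) * (x : ℂ)))⁻¹ ^ n)))
    (f := fun x : ℝ => Complex.exp (-(2 * Real.pi * Complex.I) * (k : ℂ) * (x : ℂ)) /
          ((1 : ℂ) + (c : ℂ) ^ 2 * (Real.tan (Real.pi * x) : ℂ) ^ 2))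
    (fun n _ => ‖auxB c n‖ * 2) ?_ ?_ ?_ ?_ ?_
  · simp only [aux_term] at H
    refine H.unique ?_
    convert hasSum_single k.natAbs ?_ using 1
    · split_ifs with h0 h1 h2 h2 h1 h2 h2
      all_goals first | omega | skip
      · subst h0
        simp [auxB]
        ring
      all_goals
        obtain ⟨m, hm⟩ : ∃ m, k.natAbs = m + 1 := ⟨k.natAbs - 1, by omega⟩
        simp [hm, auxB]
    · intro n hn
      rw [if_neg (by omega), if_neg (by omega)]
      simp
  · intro n
    refine Continuous.aestronglyMeasurable ?_
    simp only [← Complex.exp_neg]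
    fun_prop
  · intro n
    refine Filter.Eventually.of_forall fun x _ => ?_
    have hw : ‖Complex.exp ((2 * Real.pi * Complex.I) * (x : ℂ))‖ = 1 := by
      rw [Complex.norm_exp]; simp
    have he : ‖Complex.exp (-(2 * Real.pi * Complex.I) * (k : ℂ) * (x : ℂ))‖ = 1 := by
      rw [Complex.norm_exp]; simp
    rw [norm_mul, he, one_mul, norm_mul]
    gcongr
    refine (norm_add_le _ _).trans ?_
    rw [norm_pow, norm_pow, norm_inv, hw]
    norm_num
  · exact Filter.Eventually.of_forall fun x _ => aux_summable c hc
  · exact intervalIntegrable_const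
  · filter_upwards [hne] with x hx hm
    have := (aux_hasSum c hc x (aux_cos x hm hx) _ rfl).mul_left
      (Complex.exp (-(2 * Real.pi * Complex.I) * (k : ℂ) * (x : ℂ)))
    rwa [mul_one_div] at this
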